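/- Every planar compact convex set of diameter at most 2 has perimeter at most 2π. -/

import Mathlib

open Metric MeasureTheory

/-- Linear functional of direction `θ`. -/
noncomputable def dirL (θ : ℝ) (x : EuclideanSpace ℝ (Fin 2)) : ℝ :=
  x 0 * Real.cos θ + x 1 * Real.sin θ

/-- The parametrized line with normal direction `θ` at height `h`. -/
noncomputable def dirLine (θ h : ℝ) (s : ℝ) : EuclideanSpace ℝ (Fin 2) :=
  !₂[h * Real.cos θ - s * Real.sin θ, h * Real.sin θ + s * Real.cos θ]

lemma dirLine_isometry (θ h : ℝ) : Isometry (dirLine θ h) := by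
  refine Isometry.of_dist_eq fun s t => ?_
  rw [EuclideanSpace.dist_eq, Real.dist_eq, ← Real.sqrt_sq_eq_abs]
  congr 1
  simp only [Fin.sum_univ_two, dirLine, Real.dist_eq, sq_abs]
  simp
  linear_combination (s - t) ^ 2 * Real.sin_sq_add_cos_sq θ

lemma dirLine_param (θ h : ℝ) (y : EuclideanSpace ℝ (Fin 2)) (hy : dirL θ y = h) :
    dirLine θ h (-(y 0) * Real.sin θ + y 1 * Real.cos θ) = y := by
  subst hy
  ext i
  fin_cases i
  · simp [dirLine, dirL]
    linear_combination y 0 * Real.sin_sq_add_cos_sq θ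
  · simp [dirLine, dirL]
    linear_combination y 1 * Real.sin_sq_add_cos_sq θ

lemma dirL_shift (θ δ : ℝ) (y : EuclideanSpace ℝ (Fin 2)) :
    dirL (θ + δ) y = dirL θ y * Real.cos δ
      + (-(y 0) * Real.sin θ + y 1 * Real.cos θ) * Real.sin δ := by
  simp only [dirL, Real.cos_add, Real.sin_add]; ring

lemma dirL_shift' (θ δ : ℝ) (y : EuclideanSpace ℝ (Fin 2)) :
    dirL (θ - δ) y = dirL θ y * Real.cos δ
      - (-(y 0) * Real.sin θ + y 1 * Real.cos θ) * Real.sin δ := by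
  simp only [dirL, Real.cos_sub, Real.sin_sub]; ring

lemma dirL_pi (θ : ℝ) (y : EuclideanSpace ℝ (Fin 2)) : dirL (θ + Real.pi) y = - dirL θ y := by
  simp only [dirL, Real.cos_add_pi, Real.sin_add_pi]; ring

lemma dirL_add_smul (θ t : ℝ) (x u : EuclideanSpace ℝ (Fin 2)) :
    dirL θ (x + t • u) = dirL θ x + t * dirL θ u := by
  simp [dirL]; ring

lemma dirL_sub_le (θ : ℝ) (x y : EuclideanSpace ℝ (Fin 2)) :
    dirL θ x - dirL θ y ≤ dist x y := by
  rw [EuclideanSpace.dist_eq]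
  apply Real.le_sqrt_of_sq_le
  simp only [Fin.sum_univ_two, Real.dist_eq, sq_abs, dirL]
  nlinarith [sq_nonneg ((x 0 - y 0) * Real.sin θ - (x 1 - y 1) * Real.cos θ),
    Real.sin_sq_add_cos_sq θ,
    congrArg (fun z => ((x 0 - y 0) ^ 2 + (x 1 - y 1) ^ 2) * z) (Real.sin_sq_add_cos_sq θ)]

lemma dirL_continuous (θ : ℝ) : Continuous (dirL θ) := by
  unfold dirL; fun_prop

lemma dirL_int (θ : ℝ) (k : ℤ) : dirL (θ + k * (2 * Real.pi)) = dirL θ := by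
  funext y
  simp [dirL, Real.cos_add_int_mul_two_pi, Real.sin_add_int_mul_two_pi]

/-- Shift invariance of sums of periodic functions. -/
lemma sum_shift (g : ℝ → ℝ) (N : ℕ) (δ : ℝ) (hg : g (N * δ) = g 0) :
    ∑ k ∈ Finset.range N, g (k * δ + δ) = ∑ k ∈ Finset.range N, g (k * δ) := by
  have h1 := Finset.sum_range_succ (fun k : ℕ => g (k * δ)) N
  have h2 := Finset.sum_range_succ' (fun k : ℕ => g (k * δ)) N
  have h3 : ∀ k : ℕ, ((k + 1 : ℕ) : ℝ) * δ = k * δ + δ := by intro k; push_cast; ring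
  simp only [h3] at h2
  simp only [Nat.cast_zero, zero_mul] at h2
  linarith

/-- The nearest point projection. -/
lemma exists_proj (K : Set (EuclideanSpace ℝ (Fin 2))) (hne : K.Nonempty)
    (hKc : IsCompact K) (hKconv : Convex ℝ K) :
    ∃ p : EuclideanSpace ℝ (Fin 2) → EuclideanSpace ℝ (Fin 2), LipschitzWith 1 p ∧
      (∀ z, p z ∈ K) ∧ (∀ z ∈ K, p z = z) ∧
      ∀ z (t : ℝ), 0 ≤ t → p (p z + t • (z - p z)) = p z := by
  choose p hpK hp using exists_norm_eq_iInf_of_complete_convex hne hKc.isComplete hKconv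
  have hp' : ∀ u, ∀ w ∈ K, inner ℝ (u - p u) (w - p u) ≤ 0 := fun u =>
    (norm_eq_iInf_iff_real_inner_le_zero hKconv (hpK u)).1 (hp u)
  have uniq : ∀ y, ∀ x ∈ K, (∀ w ∈ K, inner ℝ (y - x) (w - x) ≤ 0) → p y = x := by
    intro y x hx h
    have h1 := hp' y x hx
    have h2 := h (p y) (hpK y)
    have h3 : inner ℝ (x - p y) (x - p y) =
      inner ℝ (y - p y) (x - p y) + inner ℝ (y - x) (p y - x) := by
      rw [← neg_sub x (p y), inner_neg_right, ← sub_eq_add_neg, ← inner_sub_left]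
      congr 1; abel
    have h4 : inner ℝ (x - p y) (x - p y) ≤ 0 := by linarith
    have : x - p y = 0 := by
      rw [real_inner_self_eq_norm_sq] at h4
      exact norm_eq_zero.1 (pow_eq_zero_iff two_ne_zero |>.1 (le_antisymm h4 (sq_nonneg _)))
    exact (sub_eq_zero.1 this).symm
  refine ⟨p, ?_, hpK, ?_, ?_⟩
  · refine LipschitzWith.of_dist_le_mul fun a b => ?_
    have h1 := hp' a (p b) (hpK b)
    have h2 := hp' b (p a) (hpK a)
    have h3 : inner ℝ (p a - p b) (p a - p b) = inner ℝ (a - b) (p a - p b)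
       + inner ℝ (a - p a) (p b - p a) + inner ℝ (b - p b) (p a - p b) := by
      rw [← neg_sub (p a) (p b), inner_neg_right, ← sub_eq_add_neg, ← inner_sub_left,
        ← inner_add_left]
      congr 1; abel
    have h4 := real_inner_le_norm (a - b) (p a - p b)
    rw [real_inner_self_eq_norm_sq] at h3
    rw [dist_eq_norm, dist_eq_norm, NNReal.coe_one, one_mul]
    by_contra! hcon
    nlinarith [norm_nonneg (a - b), norm_nonneg (p a - p b)]
  · intro z hz
    exact uniq z z hz (by simp)
  · intro z t ht
    refine uniq _ _ (hpK z) fun w hw => ?_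
    rw [add_sub_cancel_left, real_inner_smul_left]
    exact mul_nonpos_of_nonneg_of_nonpos ht (hp' z w hw)

lemma perimeter_le_polygon (K : Set (EuclideanSpace ℝ (Fin 2))) (hne : K.Nonempty)
    (hKc : IsCompact K) (hKconv : Convex ℝ K) (hdiam : diam K ≤ 2) (m : ℕ) (hm : 2 ≤ m) :
    μH[1] (frontier K) ≤ ENNReal.ofReal (4 * m * Real.tan (Real.pi / (2 * m))) := by
  obtain ⟨p, hpL, hpK, hpid, hpray⟩ := exists_proj K hne hKc hKconv
  have hmax : ∀ θ, ∃ x ∈ K, ∀ y ∈ K, dirL θ y ≤ dirL θ x := fun θ =>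
    hKc.exists_isMaxOn hne (dirL_continuous θ).continuousOn
  choose X hXK hX using hmax
  set g : ℝ → ℝ := fun θ => dirL θ (X θ) with hg
  have hgK : ∀ θ, ∀ y ∈ K, dirL θ y ≤ g θ := hX
  have gper : ∀ θ (k : ℤ), g (θ + k * (2 * Real.pi)) = g θ := by
    intro θ k
    apply le_antisymm
    · have := hX θ (X (θ + k * (2 * Real.pi))) (hXK _)
      simpa only [hg, dirL_int] using this
    · have := hX (θ + k * (2 * Real.pi)) (X θ) (hXK _)
      simpa only [hg, dirL_int] using this
  have gwidth : ∀ θ, g θ + g (θ + Real.pi) ≤ 2 := by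
    intro θ
    simp only [hg]
    rw [dirL_pi]
    have h1 := dirL_sub_le θ (X θ) (X (θ + Real.pi))
    have h2 := dist_le_diam_of_mem hKc.isBounded (hXK θ) (hXK (θ + Real.pi))
    linarith
  have hpi := Real.pi_pos
  have hm' : (2 : ℝ) ≤ m := by exact_mod_cast hm
  set δ : ℝ := Real.pi / m with hδ
  have hδpos : 0 < δ := by positivity
  have hmδ : m * δ = Real.pi := by rw [hδ]; field_simp
  have hδlt : δ < Real.pi := by nlinarith
  have hsin : 0 < Real.sin δ := Real.sin_pos_of_pos_of_lt_pi hδpos hδlt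
  -- the sides
  set lo : ℝ → ℝ := fun θ => -(g (θ - δ) - g θ * Real.cos δ) / Real.sin δ with hlo
  set hi : ℝ → ℝ := fun θ => (g (θ + δ) - g θ * Real.cos δ) / Real.sin δ with hhi
  have side : ∀ θ y, dirL θ y = g θ → dirL (θ + δ) y ≤ g (θ + δ) → dirL (θ - δ) y ≤ g (θ - δ) →
      (-(y 0) * Real.sin θ + y 1 * Real.cos θ) ∈ Set.Icc (lo θ) (hi θ) := by
    intro θ y h0 h1 h2
    rw [dirL_shift, h0] at h1
    rw [dirL_shift', h0] at h2
    constructor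
    · rw [hlo]; dsimp only; rw [div_le_iff₀ hsin]; linarith
    · rw [hhi]; dsimp only; rw [le_div_iff₀ hsin]; linarith
  have lohi : ∀ θ, lo θ ≤ hi θ := by
    intro θ
    have := side θ (X θ) rfl (hgK _ _ (hXK θ)) (hgK _ _ (hXK θ))
    exact this.1.trans this.2
  set T : Set (EuclideanSpace ℝ (Fin 2)) := ⋃ k ∈ Finset.range (2 * m),
    dirLine (k * δ) (g (k * δ)) '' Set.Icc (lo (k * δ)) (hi (k * δ)) with hT
  have hTc : IsCompact T := by
    apply Finset.isCompact_biUnion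
    intro k _
    exact isCompact_Icc.image (dirLine_isometry _ _).continuous
  have hTm : μH[1] T ≤ ENNReal.ofReal (4 * m * Real.tan (Real.pi / (2 * m))) := by
    calc μH[1] T ≤ ∑ k ∈ Finset.range (2 * m),
          μH[1] (dirLine (k * δ) (g (k * δ)) '' Set.Icc (lo (k * δ)) (hi (k * δ))) :=
          measure_biUnion_finset_le _ _
      _ = ∑ k ∈ Finset.range (2 * m), ENNReal.ofReal (hi (k * δ) - lo (k * δ)) := by
          refine Finset.sum_congr rfl fun k _ => ?_
          rw [(dirLine_isometry _ _).hausdorffMeasure_image (Or.inl zero_le_one),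
            hausdorffMeasure_real, Real.volume_Icc]
      _ = ENNReal.ofReal (∑ k ∈ Finset.range (2 * m), (hi (k * δ) - lo (k * δ))) := by
          rw [ENNReal.ofReal_sum_of_nonneg]
          intro k _
          exact sub_nonneg.2 (lohi _)
      _ ≤ _ := by
          apply ENNReal.ofReal_le_ofReal
          have e1 : ∀ θ, hi θ - lo θ =
              (g (θ + δ) + g (θ - δ) - 2 * Real.cos δ * g θ) / Real.sin δ := by
            intro θ; simp only [hlo, hhi]; ring
          simp only [e1]
          rw [← Finset.sum_div, Finset.sum_sub_distrib, Finset.sum_add_distrib, ← Finset.mul_sum]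
          have hN : ((2 * m : ℕ) : ℝ) * δ = 2 * Real.pi := by push_cast; linarith
          have s1 := sum_shift g (2 * m) δ (by rw [hN]; simpa using gper 0 1)
          have s2 := sum_shift (fun θ => g (θ - δ)) (2 * m) δ (by
            have := gper (0 - δ) 1
            rw [hN, ← this]; congr 1; push_cast; ring)
          simp only [add_sub_cancel_right] at s2
          rw [s1, ← s2]
          set S := ∑ k ∈ Finset.range (2 * m), g (k * δ) with hS
          have hS2 : S ≤ 2 * m := by
            rw [hS, two_mul m, Finset.sum_range_add, ← Finset.sum_add_distrib]
            calc _ ≤ ∑ k ∈ Finset.range m, (2 : ℝ) := by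
                  refine Finset.sum_le_sum fun k _ => ?_
                  have := gwidth (k * δ)
                  have e : ((m + k : ℕ) : ℝ) * δ = k * δ + Real.pi := by
                    push_cast; linarith
                  rw [e]; exact this
              _ = _ := by simp [mul_comm]
          have ha : Real.pi / (2 * m) = δ / 2 := by rw [hδ]; ring
          rw [ha]
          have hsa : 0 < Real.sin (δ / 2) :=
            Real.sin_pos_of_pos_of_lt_pi (by linarith) (by linarith)
          have hca : 0 < Real.cos (δ / 2) :=
            Real.cos_pos_of_mem_Ioo ⟨by linarith, by linarith⟩
          have c1 : Real.cos δ = 1 - 2 * Real.sin (δ / 2) ^ 2 := by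
            have := Real.cos_two_mul (δ / 2)
            rw [mul_div_cancel₀ _ two_ne_zero] at this
            rw [this, Real.cos_sq']; ring
          have c2 : Real.sin δ = 2 * Real.sin (δ / 2) * Real.cos (δ / 2) := by
            have := Real.sin_two_mul (δ / 2)
            rwa [mul_div_cancel₀ _ two_ne_zero] at this
          have : (S + S - 2 * Real.cos δ * S) / Real.sin δ = 2 * Real.tan (δ / 2) * S := by
            rw [c1, c2, Real.tan_eq_sin_div_cos]; field_simp; ring
          rw [this]
          have ht : 0 < Real.tan (δ / 2) := by rw [Real.tan_eq_sin_div_cos]; positivity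
          nlinarith
  have hout : ∀ z, z ∉ K → p z ∈ p '' T := by
    intro z hz
    set u := z - p z with hu
    have hu0 : u ≠ 0 := by
      intro h
      rw [hu, sub_eq_zero] at h
      exact hz (h ▸ hpK z)
    have hred : ∀ k : ℤ, ∃ n ∈ Finset.range (2 * m),
        dirL (k * δ) = dirL (n * δ) ∧ g (k * δ) = g (n * δ) := by
      intro k
      have hpos : (0 : ℤ) < (2 * m : ℕ) := by exact_mod_cast (by omega : 0 < 2 * m)
      have hlt := Int.emod_lt_of_pos k hpos
      have hnn := Int.emod_nonneg k hpos.ne'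
      obtain ⟨n, hn⟩ := Int.eq_ofNat_of_zero_le hnn
      refine ⟨n, by rw [Finset.mem_range]; omega, ?_⟩
      have hk := Int.emod_add_mul_ediv k (2 * m : ℕ)
      rw [hn] at hk
      have hk' : (k : ℝ) * δ = n * δ + (k / (2 * m : ℕ) : ℤ) * (2 * Real.pi) := by
        rw [← hmδ]
        have : (k : ℝ) = n + (2 * m) * (k / (2 * m : ℕ) : ℤ) := by exact_mod_cast hk.symm
        conv_lhs => rw [this]
        ring
      rw [hk']
      exact ⟨dirL_int _ _, gper _ _⟩
    have hex : ∃ n ∈ Finset.range (2 * m), 0 < dirL (n * δ) u := by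
      by_contra! hcon
      have hall : ∀ k : ℤ, dirL (k * δ) u ≤ 0 := by
        intro k
        obtain ⟨n, hn, h1, _⟩ := hred k
        rw [h1]; exact hcon n hn
      have hall0 : ∀ k : ℤ, dirL (k * δ) u = 0 := by
        intro k
        refine le_antisymm (hall k) ?_
        have := hall (k + m)
        have e : ((k + m : ℤ) : ℝ) * δ = k * δ + Real.pi := by push_cast; linarith
        rw [e, dirL_pi] at this
        linarith
      have h0 := hall0 0
      have h1 := hall0 1
      simp [dirL] at h0 h1
      rw [h0] at h1
      simp [hsin.ne'] at h1
      apply hu0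
      ext i; fin_cases i
      · simpa using h0
      · simpa using h1
    obtain ⟨n, hn, hmin⟩ := Finset.exists_min_image
      ((Finset.range (2 * m)).filter fun n : ℕ => 0 < dirL (n * δ) u)
      (fun n : ℕ => (g (n * δ) - dirL (n * δ) (p z)) / dirL (n * δ) u)
      (by obtain ⟨n, h1, h2⟩ := hex; exact ⟨n, Finset.mem_filter.2 ⟨h1, h2⟩⟩)
    obtain ⟨hnr, hnpos⟩ := Finset.mem_filter.1 hn
    set t := (g (n * δ) - dirL (n * δ) (p z)) / dirL (n * δ) u with ht
    have ht0 : 0 ≤ t := div_nonneg (sub_nonneg.2 (hgK _ _ (hpK z))) hnpos.le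
    have hyP : ∀ k : ℤ, dirL (k * δ) (p z + t • u) ≤ g (k * δ) := by
      intro k
      obtain ⟨j, hj, h1, h2⟩ := hred k
      rw [h1, h2, dirL_add_smul]
      have h3 := hgK (j * δ) _ (hpK z)
      by_cases hjp : 0 < dirL (j * δ) u
      · have := hmin j (Finset.mem_filter.2 ⟨hj, hjp⟩)
        rw [le_div_iff₀ hjp] at this
        linarith
      · have := mul_nonpos_of_nonneg_of_nonpos ht0 (not_lt.1 hjp)
        linarith
    have hyn : dirL (n * δ) (p z + t • u) = g (n * δ) := by
      rw [dirL_add_smul, ht, div_mul_cancel₀ _ hnpos.ne']; ring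
    refine ⟨p z + t • u, ?_, hpray z t ht0⟩
    refine Set.mem_biUnion hnr ⟨_, side (n * δ) _ hyn ?_ ?_, dirLine_param _ _ _ hyn⟩
    · have := hyP (n + 1)
      have e : ((n + 1 : ℤ) : ℝ) * δ = n * δ + δ := by push_cast; ring
      rwa [e] at this
    · have := hyP (n - 1)
      have e : ((n - 1 : ℤ) : ℝ) * δ = n * δ - δ := by push_cast; ring
      rwa [e] at this
  have hsub : frontier K ⊆ p '' T := by
    intro x hx
    have hxK : x ∈ K := hKc.isClosed.frontier_subset hx
    have hcl : IsClosed (p ⁻¹' (p '' T)) :=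
      (hTc.image hpL.continuous).isClosed.preimage hpL.continuous
    have : closure Kᶜ ⊆ p ⁻¹' (p '' T) := closure_minimal (fun z hz => hout z hz) hcl
    rw [frontier_eq_closure_inter_closure] at hx
    have := this hx.2
    rwa [Set.mem_preimage, hpid x hxK] at this
  calc μH[1] (frontier K) ≤ μH[1] (p '' T) := measure_mono hsub
    _ ≤ _ := hpL.hausdorffMeasure_image_le zero_le_one T
    _ ≤ _ := by simpa using hTm

lemma tendsto_bound : Filter.Tendsto (fun m : ℕ => 4 * (m : ℝ) * Real.tan (Real.pi / (2 * m)))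
    Filter.atTop (nhds (2 * Real.pi)) := by
  have h : HasDerivAt Real.tan 1 0 := by
    simpa using Real.hasDerivAt_tan (x := 0) (by simp)
  rw [hasDerivAt_iff_tendsto_slope] at h
  have h2 : Filter.Tendsto (fun m : ℕ => Real.pi / (2 * (m : ℝ))) Filter.atTop
      (nhdsWithin 0 {0}ᶜ) := by
    refine tendsto_nhdsWithin_iff.2 ⟨?_, ?_⟩
    · exact (tendsto_natCast_atTop_atTop.const_mul_atTop two_pos).const_div_atTop _
    · filter_upwards [Filter.eventually_gt_atTop 0] with m hm
      have : (0 : ℝ) < m := by exact_mod_cast hm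
      have := Real.pi_pos
      simp only [Set.mem_compl_iff, Set.mem_singleton_iff]
      positivity
  have h3 := (h.comp h2).const_mul (2 * Real.pi)
  rw [mul_one] at h3
  refine h3.congr' ?_
  filter_upwards [Filter.eventually_gt_atTop 0] with m hm
  have : (0 : ℝ) < m := by exact_mod_cast hm
  have := Real.pi_pos
  simp only [Function.comp, slope_def_field, Real.tan_zero, sub_zero]
  field_simp
  ring

/-- Every planar compact convex set of diameter at most 2 has perimeter at most `2π`. -/
theorem stmt4 (K : Set (EuclideanSpace ℝ (Fin 2)))
    (hKc : IsCompact K) (hKconv : Convex ℝ K) (hdiam : diam K ≤ 2) :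
    μH[1] (frontier K) ≤ ENNReal.ofReal (2 * Real.pi) := by
  rcases K.eq_empty_or_nonempty with rfl | hne
  · simp
  refine ge_of_tendsto ((ENNReal.continuous_ofReal.tendsto _).comp tendsto_bound) ?_
  filter_upwards [Filter.eventually_ge_atTop 2] with m hm
  exact perimeter_le_polygon K hne hKc hKconv hdiam m hm
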